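/- Let 0 ≤ a < 1 < b ≤ ∞, let f : (a,b) → ℝ be convex with f(1) = 0, let ℒ : 𝒵 → ℝ be measurable, and let P_n be the empirical distribution of points z_1, …, z_n ∈ 𝒵. Then for all δ > 0 and κ ≥ 0 strong duality holds: inf_{Q : D_f(Q‖P_n) ≤ δ} { E_Q[ℒ] + κ D_f(Q‖P_n) } = sup_{λ > 0} { −λδ + inf_{Q : D_f(Q‖P_n) < ∞} { E_Q[ℒ] + (λ + κ) D_f(Q‖P_n) } }. -/

import Mathlib

open MeasureTheory Classical
open scoped ENNReal BigOperators

/-- The empirical distribution `P_n = (1/n) ∑ᵢ δ_{zᵢ}` of points `z₁, …, zₙ`. -/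
noncomputable def empDist {𝒵 : Type*} [MeasurableSpace 𝒵] (n : ℕ) (z : Fin n → 𝒵) :
    Measure 𝒵 :=
  ((n : ℝ≥0∞))⁻¹ • ∑ i : Fin n, Measure.dirac (z i)

/-- The `f`-divergence for `f` defined on the interval `(a, b)` (with `b` possibly `∞`):
`D_f(Q ‖ P) = E_P[f(dQ/dP)]` when `Q ≪ P`, `dQ/dP` takes values in `[a, b]` a.e. (where `f`
is understood as continuously extended to the endpoints) and the integrand is integrable;
`∞` otherwise. -/
noncomputable def fDivOn {Ω : Type*} [MeasurableSpace Ω] (a : ℝ) (b : EReal) (f : ℝ → ℝ)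
    (Q P : Measure Ω) : EReal :=
  if Q ≪ P ∧ (∀ᵐ ω ∂P, a ≤ ((Q.rnDeriv P) ω).toReal ∧ (((Q.rnDeriv P) ω).toReal : EReal) ≤ b)
      ∧ Integrable (fun ω => f ((Q.rnDeriv P) ω).toReal) P
  then ((∫ ω, f ((Q.rnDeriv P) ω).toReal ∂P : ℝ) : EReal)
  else ⊤

lemma aux_mult {ι : Type*} (g h : ι → ℝ) (v : ℝ)
    (hc : ∀ p q : ι, ∀ t s : ℝ, 0 ≤ t → 0 ≤ s → t + s = 1 →
      ∃ r, g r ≤ t * g p + s * g q ∧ h r ≤ t * h p + s * h q)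
    (hv : ∀ p, h p ≤ 0 → v ≤ g p) (i0 : ι) (h0 : h i0 < 0) :
    ∃ l : ℝ, 0 ≤ l ∧ ∀ p, v ≤ g p + l * h p := by
  have key : ∀ p q, 0 < h p → h q < 0 → (v - g p) / h p ≤ (g q - v) / (- h q) := by
    intro p q hp hq
    have hD : 0 < h p - h q := by linarith
    obtain ⟨r, hr1, hr2⟩ := hc p q (- h q / (h p - h q)) (h p / (h p - h q))
      (div_nonneg (by linarith) hD.le) (div_nonneg hp.le hD.le) (by field_simp; ring)
    have e2 : - h q / (h p - h q) * h p + h p / (h p - h q) * h q = 0 := by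
      field_simp; ring
    have := hv r (by linarith)
    have h3 : v ≤ (- h q * g p + h p * g q) / (h p - h q) := by
      calc v ≤ _ := this.trans hr1
        _ = _ := by field_simp
    rw [le_div_iff₀ hD] at h3
    rw [div_le_div_iff₀ hp (by linarith)]
    linarith
  let A : Set ℝ := {x | x = 0 ∨ ∃ p, 0 < h p ∧ x = (v - g p) / h p}
  have hub : ∀ q, h q < 0 → ∀ x ∈ A, x ≤ (g q - v) / (- h q) := by
    rintro q hq x (rfl | ⟨p, hp, rfl⟩)
    · exact div_nonneg (by linarith [hv q hq.le]) (by linarith)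
    · exact key p q hp hq
  have hbdd : BddAbove A := ⟨_, fun x hx => hub i0 h0 x hx⟩
  have hne : A.Nonempty := ⟨0, Or.inl rfl⟩
  refine ⟨sSup A, le_csSup hbdd (Or.inl rfl), fun p => ?_⟩
  rcases lt_trichotomy (h p) 0 with hp | hp | hp
  · have := csSup_le hne (hub p hp)
    rw [le_div_iff₀ (by linarith)] at this
    linarith
  · rw [hp]; simpa using hv p hp.le
  · have := le_csSup hbdd (show (v - g p) / h p ∈ A from Or.inr ⟨p, hp, rfl⟩)
    rw [div_le_iff₀ hp] at this
    linarith

lemma aux_cont (a : ℝ) (b : EReal)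
    (f : ℝ → ℝ) (hf_cvx : ConvexOn ℝ {x : ℝ | a < x ∧ (x : EReal) < b} f)
    (hfa : ContinuousWithinAt f (Set.Ioi a) a)
    (hfb : ∀ c : ℝ, b = (c : EReal) → ContinuousWithinAt f (Set.Iio c) c) :
    ContinuousOn f {x : ℝ | a ≤ x ∧ (x : EReal) ≤ b} := by
  have hopen : IsOpen {x : ℝ | a < x ∧ (x : EReal) < b} :=
    (isOpen_lt continuous_const continuous_id).inter
      (isOpen_lt continuous_coe_real_ereal continuous_const)
  have hint := hf_cvx.continuousOn hopen
  rintro x ⟨hx1, hx2⟩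
  rcases hx1.eq_or_lt with rfl | hx1
  · have : ContinuousWithinAt f (Set.Ici a) a := by
      rw [← Set.Ioi_insert]; exact hfa.insert
    exact this.mono fun y hy => hy.1
  rcases hx2.eq_or_lt with hx2 | hx2
  · have : ContinuousWithinAt f (Set.Iic x) x := by
      rw [← Set.Iio_insert]; exact (hfb x hx2.symm).insert
    refine this.mono fun y hy => ?_
    have h2 := hy.2
    rw [← hx2] at h2
    exact EReal.coe_le_coe_iff.1 h2
  · exact (hint.continuousAt (hopen.mem_nhds ⟨hx1, hx2⟩)).continuousWithinAt

lemma aux_convexSet (a : ℝ) (b : EReal) : Convex ℝ {x : ℝ | a ≤ x ∧ (x : EReal) ≤ b} := by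
  apply Set.OrdConnected.convex
  refine ⟨fun x hx y hy w hw => ⟨hx.1.trans hw.1, le_trans (EReal.coe_le_coe_iff.2 hw.2) hy.2⟩⟩

lemma aux_convex (a : ℝ) (b : EReal) (ha1 : (a : EReal) < 1) (hb1 : (1 : EReal) < b)
    (f : ℝ → ℝ) (hf_cvx : ConvexOn ℝ {x : ℝ | a < x ∧ (x : EReal) < b} f)
    (hc : ContinuousOn f {x : ℝ | a ≤ x ∧ (x : EReal) ≤ b}) :
    ConvexOn ℝ {x : ℝ | a ≤ x ∧ (x : EReal) ≤ b} f := by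
  have ha : a < 1 := by exact_mod_cast ha1
  set S := {x : ℝ | a ≤ x ∧ (x : EReal) ≤ b} with hS
  have hSc : Convex ℝ S := aux_convexSet a b
  have h1S : (1 : ℝ) ∈ S := ⟨ha.le, by exact_mod_cast hb1.le⟩
  have hpath : ∀ x ∈ S, ∀ e : ℝ, 0 < e → e < 1 →
      (1 - e) * x + e * 1 ∈ {x : ℝ | a < x ∧ (x : EReal) < b} := by
    intro x hx e he he1
    refine ⟨by nlinarith [hx.1], ?_⟩
    rcases le_total x 1 with h | h
    · refine lt_of_le_of_lt ?_ hb1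
      have : (1 - e) * x + e * 1 ≤ 1 := by nlinarith
      exact_mod_cast this
    · rcases h.eq_or_lt with h | h
      · rw [← h]; ring_nf; exact_mod_cast hb1
      · refine lt_of_lt_of_le ?_ hx.2
        rw [EReal.coe_lt_coe_iff]; nlinarith
  have hlim : ∀ x ∈ S, Filter.Tendsto (fun e : ℝ => f ((1 - e) * x + e * 1))
      (nhdsWithin 0 (Set.Ioo 0 1)) (nhds (f x)) := by
    intro x hx
    have hcx := hc x hx
    refine Filter.Tendsto.comp hcx (tendsto_nhdsWithin_iff.2 ⟨?_, ?_⟩)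
    · have : ContinuousAt (fun e : ℝ => (1 - e) * x + e * 1) 0 := by fun_prop
      have h2 := this.tendsto
      simp only [sub_zero, one_mul, zero_mul, add_zero] at h2
      exact h2.mono_left nhdsWithin_le_nhds
    · filter_upwards [self_mem_nhdsWithin] with e he
      exact ⟨(hpath x hx e he.1 he.2).1.le, (hpath x hx e he.1 he.2).2.le⟩
  refine ⟨hSc, fun x hx y hy t s ht hs hts => ?_⟩
  have hne : (nhdsWithin (0:ℝ) (Set.Ioo 0 1)).NeBot := by
    rw [nhdsWithin_Ioo_eq_nhdsGT one_pos]; infer_instance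
  have hm := hSc hx hy ht hs hts
  refine le_of_tendsto_of_tendsto (hlim _ hm)
    (((hlim x hx).const_mul t).add ((hlim y hy).const_mul s)) ?_
  filter_upwards [self_mem_nhdsWithin] with e he
  have := hf_cvx.2 (hpath x hx e he.1 he.2) (hpath y hy e he.1 he.2) ht hs hts
  simp only [smul_eq_mul] at this ⊢
  convert this using 2
  linear_combination (-e) * hts

lemma aux_ae {𝒵 : Type*} [MeasurableSpace 𝒵] (n : ℕ) (z : Fin n → 𝒵) (p : 𝒵 → Prop)
    (hp : MeasurableSet {x | p x}) (h : ∀ i, p (z i)) : ∀ᵐ x ∂(empDist n z), p x := by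
  unfold empDist
  apply Measure.ae_smul_measure
  rw [ae_finsetSum_measure_iff]
  intro i _
  rw [ae_dirac_iff hp]
  exact h i

lemma aux_prob {𝒵 : Type*} [MeasurableSpace 𝒵] (n : ℕ) (hn : 0 < n) (z : Fin n → 𝒵) :
    IsProbabilityMeasure (empDist n z) := by
  constructor
  simp only [empDist, Measure.smul_apply, Measure.coe_finsetSum, Finset.sum_apply,
    measure_univ, Finset.sum_const, Finset.card_univ, Fintype.card_fin, smul_eq_mul,
    nsmul_eq_mul, mul_one]
  exact ENNReal.inv_mul_cancel (by exact_mod_cast hn.ne') (by simp)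

lemma aux_int {𝒵 : Type*} [MeasurableSpace 𝒵] (n : ℕ) (hn : 0 < n) (z : Fin n → 𝒵)
    (r : 𝒵 → ℝ≥0∞) (hr : Measurable r) (F : ℝ≥0∞ → ℝ) :
    Integrable (fun x => F (r x)) (empDist n z) := by
  unfold empDist
  apply Integrable.smul_measure _ (by simp [hn.ne'])
  rw [integrable_finsetSum_measure]
  intro i _
  have : (fun x => F (r x)) =ᵐ[Measure.dirac (z i)] fun _ => F (r (z i)) := by
    have h : ∀ᵐ x ∂(Measure.dirac (z i)), r x = r (z i) := by
      exact (ae_dirac_iff (p := fun x => r x = r (z i))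
        (hr (measurableSet_singleton (r (z i))))).2 rfl
    filter_upwards [h] with x hx
    rw [hx]
  exact (integrable_const _).congr this.symm

lemma aux_L {𝒵 : Type*} [MeasurableSpace 𝒵] (n : ℕ) (z : Fin n → 𝒵)
    (L : 𝒵 → ℝ) (hL : Measurable L) (Q : Measure 𝒵) [IsFiniteMeasure Q]
    (hQ : Q ≪ empDist n z) : Integrable L Q := by
  have h : ∀ᵐ x ∂(empDist n z), ‖L x‖ ≤ ∑ i, ‖L (z i)‖ := by
    apply aux_ae
    · exact measurableSet_le hL.norm measurable_const
    · intro i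
      exact Finset.single_le_sum (f := fun i => ‖L (z i)‖) (fun _ _ => norm_nonneg _)
        (Finset.mem_univ i)
  exact Integrable.of_bound hL.aestronglyMeasurable _ (hQ.ae_le h)

lemma aux_fin {Ω : Type*} [MeasurableSpace Ω] {a : ℝ} {b : EReal} {f : ℝ → ℝ}
    {Q P : Measure Ω} (h : fDivOn a b f Q P < ⊤) :
    (Q ≪ P ∧ (∀ᵐ ω ∂P, a ≤ ((Q.rnDeriv P) ω).toReal ∧ (((Q.rnDeriv P) ω).toReal : EReal) ≤ b)
      ∧ Integrable (fun ω => f ((Q.rnDeriv P) ω).toReal) P) ∧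
    fDivOn a b f Q P = ((∫ ω, f ((Q.rnDeriv P) ω).toReal ∂P : ℝ) : EReal) := by
  unfold fDivOn at h ⊢
  split_ifs at h ⊢ with hh
  · exact ⟨hh, rfl⟩
  · simp at h

lemma aux_comb {𝒵 : Type*} [MeasurableSpace 𝒵] (n : ℕ) (hn : 0 < n) (z : Fin n → 𝒵)
    (a : ℝ) (b : EReal) (f : ℝ → ℝ)
    (hf : ConvexOn ℝ {x : ℝ | a ≤ x ∧ (x : EReal) ≤ b} f)
    (L : 𝒵 → ℝ) (hL : Measurable L) (Q1 Q2 : Measure 𝒵)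
    (h1 : IsProbabilityMeasure Q1 ∧ fDivOn a b f Q1 (empDist n z) < ⊤)
    (h2 : IsProbabilityMeasure Q2 ∧ fDivOn a b f Q2 (empDist n z) < ⊤)
    (t s : NNReal) (hts : t + s = 1) :
    ∃ Q : Measure 𝒵, (IsProbabilityMeasure Q ∧ fDivOn a b f Q (empDist n z) < ⊤) ∧
      ∫ x, L x ∂Q = t * ∫ x, L x ∂Q1 + s * ∫ x, L x ∂Q2 ∧
      (fDivOn a b f Q (empDist n z)).toReal ≤ t * (fDivOn a b f Q1 (empDist n z)).toReal
        + s * (fDivOn a b f Q2 (empDist n z)).toReal := by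
  obtain ⟨i1, h1⟩ := h1
  obtain ⟨i2, h2⟩ := h2
  have iP := aux_prob n hn z
  set P := empDist n z with hP
  obtain ⟨⟨ac1, r1, int1⟩, e1⟩ := aux_fin h1
  obtain ⟨⟨ac2, r2, int2⟩, e2⟩ := aux_fin h2
  have hac : t • Q1 + s • Q2 ≪ P := by
    refine Measure.AbsolutelyContinuous.add_left (ac1.smul_left t) (ac2.smul_left s)
  have hpr : IsProbabilityMeasure (t • Q1 + s • Q2) := by
    constructor
    simp only [Measure.add_apply, Measure.smul_apply, measure_univ]
    rw [ENNReal.smul_def, ENNReal.smul_def]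
    simp only [smul_eq_mul, mul_one]
    exact_mod_cast hts
  have hts' : (t : ℝ) + s = 1 := by exact_mod_cast hts
  have hrn : ∀ᵐ x ∂P, ((t • Q1 + s • Q2).rnDeriv P x).toReal
      = t * (Q1.rnDeriv P x).toReal + s * (Q2.rnDeriv P x).toReal := by
    filter_upwards [Measure.rnDeriv_add (t • Q1) (s • Q2) P, Measure.rnDeriv_smul_left Q1 P t,
      Measure.rnDeriv_smul_left Q2 P s, Measure.rnDeriv_lt_top Q1 P,
      Measure.rnDeriv_lt_top Q2 P] with x k1 k2 k3 k4 k5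
    rw [k1, Pi.add_apply, k2, k3, Pi.smul_apply, Pi.smul_apply, ENNReal.smul_def,
      ENNReal.smul_def, smul_eq_mul, smul_eq_mul, ENNReal.toReal_add
        (ENNReal.mul_ne_top ENNReal.coe_ne_top k4.ne)
        (ENNReal.mul_ne_top ENNReal.coe_ne_top k5.ne)]
    simp
  have hrange : ∀ᵐ x ∂P, a ≤ ((t • Q1 + s • Q2).rnDeriv P x).toReal ∧
      (((t • Q1 + s • Q2).rnDeriv P x).toReal : EReal) ≤ b := by
    filter_upwards [hrn, r1, r2] with x k1 k2 k3
    rw [k1]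
    exact hf.1 k2 k3 t.2 s.2 hts'
  have hint : Integrable (fun x => f ((t • Q1 + s • Q2).rnDeriv P x).toReal) P :=
    aux_int n hn z _ (Measure.measurable_rnDeriv _ _) (fun y => f y.toReal)
  have e3 : fDivOn a b f (t • Q1 + s • Q2) P =
      ((∫ ω, f (((t • Q1 + s • Q2).rnDeriv P) ω).toReal ∂P : ℝ) : EReal) := by
    unfold fDivOn
    rw [if_pos ⟨hac, hrange, hint⟩]
  refine ⟨t • Q1 + s • Q2, ⟨hpr, ?_⟩, ?_, ?_⟩
  · rw [e3]; exact EReal.coe_lt_top _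
  · rw [integral_add_measure ((aux_L n z L hL Q1 ac1).smul_measure_nnreal)
      ((aux_L n z L hL Q2 ac2).smul_measure_nnreal), integral_smul_nnreal_measure,
      integral_smul_nnreal_measure]
    rfl
  · rw [e1, e2, e3]
    simp only [EReal.toReal_coe]
    rw [← integral_const_mul, ← integral_const_mul, ← integral_add
      (int1.const_mul _) (int2.const_mul _)]
    refine integral_mono_ae hint ((int1.const_mul _).add (int2.const_mul _)) ?_
    filter_upwards [hrn, r1, r2] with x k1 k2 k3
    rw [k1]
    exact hf.2 k2 k3 t.2 s.2 hts'

lemma aux_self {𝒵 : Type*} [MeasurableSpace 𝒵] (n : ℕ) (hn : 0 < n) (z : Fin n → 𝒵)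
    (a : ℝ) (b : EReal) (ha1 : (a : EReal) < 1) (hb1 : (1 : EReal) < b) (f : ℝ → ℝ)
    (hf1 : f 1 = 0) : fDivOn a b f (empDist n z) (empDist n z) = 0 := by
  have iP := aux_prob n hn z
  have ha : a < 1 := by exact_mod_cast ha1
  have hs := Measure.rnDeriv_self (empDist n z)
  have hf0 : (fun x => f ((empDist n z).rnDeriv (empDist n z) x).toReal)
      =ᵐ[empDist n z] fun _ => 0 := by
    filter_upwards [hs] with x hx
    simp [hx, hf1]
  have hr : ∀ᵐ x ∂(empDist n z), a ≤ ((empDist n z).rnDeriv (empDist n z) x).toReal ∧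
      (((empDist n z).rnDeriv (empDist n z) x).toReal : EReal) ≤ b := by
    filter_upwards [hs] with x hx
    rw [hx]
    simp only [ENNReal.toReal_one]
    exact ⟨ha.le, by exact_mod_cast hb1.le⟩
  unfold fDivOn
  rw [if_pos ⟨Measure.AbsolutelyContinuous.rfl, hr, (integrable_zero _ _ _).congr hf0.symm⟩,
    integral_congr_ae hf0]
  simp

lemma aux_nonneg {𝒵 : Type*} [MeasurableSpace 𝒵] (n : ℕ) (hn : 0 < n) (z : Fin n → 𝒵)
    (a : ℝ) (b : EReal) (f : ℝ → ℝ)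
    (hf : ConvexOn ℝ {x : ℝ | a ≤ x ∧ (x : EReal) ≤ b} f)
    (hc : ContinuousOn f {x : ℝ | a ≤ x ∧ (x : EReal) ≤ b}) (hf1 : f 1 = 0)
    (Q : Measure 𝒵) (h1 : IsProbabilityMeasure Q ∧ fDivOn a b f Q (empDist n z) < ⊤) :
    0 ≤ (fDivOn a b f Q (empDist n z)).toReal := by
  obtain ⟨i1, h1⟩ := h1
  have iP := aux_prob n hn z
  obtain ⟨⟨ac1, r1, int1⟩, e1⟩ := aux_fin h1
  rw [e1, EReal.toReal_coe]
  have hcl : IsClosed {x : ℝ | a ≤ x ∧ (x : EReal) ≤ b} :=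
    (isClosed_le continuous_const continuous_id).inter
      (isClosed_le continuous_coe_real_ereal continuous_const)
  have := hf.map_integral_le hc hcl r1 Measure.integrable_toReal_rnDeriv int1
  rw [Measure.integral_toReal_rnDeriv ac1] at this
  simpa [hf1] using this

/-- Strong duality:
`inf_{Q : D_f(Q‖Pₙ) ≤ δ} {E_Q[ℒ] + κ D_f(Q‖Pₙ)}
  = sup_{λ>0} {−λδ + inf_{Q : D_f(Q‖Pₙ) < ∞} {E_Q[ℒ] + (λ+κ) D_f(Q‖Pₙ)}}`. -/
theorem relaxed_problem_strong_duality
    {𝒵 : Type*} [MeasurableSpace 𝒵] (n : ℕ) (hn : 0 < n) (z : Fin n → 𝒵)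
    (a : ℝ) (b : EReal) (ha0 : 0 ≤ a) (ha1 : (a : EReal) < 1) (hb1 : (1 : EReal) < b)
    (f : ℝ → ℝ) (hf_cvx : ConvexOn ℝ {x : ℝ | a < x ∧ (x : EReal) < b} f) (hf1 : f 1 = 0)
    (hfa : ContinuousWithinAt f (Set.Ioi a) a)
    (hfb : ∀ c : ℝ, b = (c : EReal) → ContinuousWithinAt f (Set.Iio c) c)
    (L : 𝒵 → ℝ) (hL : Measurable L)
    (δ : ℝ) (hδ : 0 < δ) (κ : ℝ) (hκ : 0 ≤ κ) :
    (⨅ Q : {Q : Measure 𝒵 // IsProbabilityMeasure Q ∧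
        fDivOn a b f Q (empDist n z) ≤ (δ : EReal)},
      ((∫ ζ, L ζ ∂(Q : Measure 𝒵) : ℝ) : EReal) + (κ : EReal) * fDivOn a b f Q (empDist n z))
    = ⨆ lam : {l : ℝ // 0 < l},
        (((-((lam : ℝ) * δ) : ℝ)) : EReal)
          + ⨅ Q : {Q : Measure 𝒵 // IsProbabilityMeasure Q ∧
              fDivOn a b f Q (empDist n z) < ⊤},
            ((∫ ζ, L ζ ∂(Q : Measure 𝒵) : ℝ) : EReal)
              + (((lam : ℝ) + κ : ℝ) : EReal) * fDivOn a b f Q (empDist n z) := by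
  have hc := aux_cont a b f hf_cvx hfa hfb
  have hf := aux_convex a b ha1 hb1 f hf_cvx hc
  have hself := aux_self n hn z a b ha1 hb1 f hf1
  have hnn := aux_nonneg n hn z a b f hf hc hf1
  have iP := aux_prob n hn z
  have hcoe : ∀ Q : Measure 𝒵, fDivOn a b f Q (empDist n z) < ⊤ →
      fDivOn a b f Q (empDist n z) = (((fDivOn a b f Q (empDist n z)).toReal : ℝ) : EReal) := by
    intro Q hQ
    rw [(aux_fin hQ).2, EReal.toReal_coe]
  have hcomb := aux_comb n hn z a b f hf L hL
  apply le_antisymm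
  · by_contra hlt
    rw [not_le] at hlt
    obtain ⟨x, hx1, hx2⟩ := EReal.lt_iff_exists_real_btwn.1 hlt
    have hbound : ∀ Q : Measure 𝒵, IsProbabilityMeasure Q → 
        fDivOn a b f Q (empDist n z) ≤ (δ : EReal) → 
        (⨅ Q : {Q : Measure 𝒵 // IsProbabilityMeasure Q ∧
            fDivOn a b f Q (empDist n z) ≤ (δ : EReal)},
          ((∫ ζ, L ζ ∂(Q : Measure 𝒵) : ℝ) : EReal)
            + (κ : EReal) * fDivOn a b f Q (empDist n z)) ≤
        ((∫ ζ, L ζ ∂Q + κ * (fDivOn a b f Q (empDist n z)).toReal : ℝ) : EReal) := by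
      intro Q hQ1 hQ2
      refine (iInf_le _ (⟨Q, hQ1, hQ2⟩ : {Q : Measure 𝒵 // IsProbabilityMeasure Q ∧
            fDivOn a b f Q (empDist n z) ≤ (δ : EReal)})).trans ?_
      have h := hcoe Q (hQ2.trans_lt (EReal.coe_lt_top δ))
      dsimp only
      rw [h, EReal.toReal_coe]
      push_cast
      exact le_rfl
    generalize (⨅ Q : {Q : Measure 𝒵 // IsProbabilityMeasure Q ∧
            fDivOn a b f Q (empDist n z) ≤ (δ : EReal)},
          ((∫ ζ, L ζ ∂(Q : Measure 𝒵) : ℝ) : EReal)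
            + (κ : EReal) * fDivOn a b f Q (empDist n z)) = V at hbound hx2 hlt
    have hP := hbound (empDist n z) iP (by rw [hself]; exact_mod_cast hδ.le)
    have hVtop : V ≠ ⊤ := (hP.trans_lt (EReal.coe_lt_top _)).ne
    have hVbot : V ≠ ⊥ := (bot_le.trans_lt hx2).ne'
    lift V to ℝ using ⟨hVtop, hVbot⟩ with v
    have hxv : x < v := by exact_mod_cast hx2
    obtain ⟨l, hl0, hl⟩ := aux_mult
      (ι := {Q : Measure 𝒵 // IsProbabilityMeasure Q ∧ fDivOn a b f Q (empDist n z) < ⊤})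
      (fun Q => ∫ ζ, L ζ ∂(Q : Measure 𝒵) + κ * (fDivOn a b f Q (empDist n z)).toReal)
      (fun Q => (fDivOn a b f Q (empDist n z)).toReal - δ) v
      (by
        rintro ⟨Q1, hQ1⟩ ⟨Q2, hQ2⟩ t s ht hs hts
        lift t to NNReal using ht
        lift s to NNReal using hs
        obtain ⟨Q, hQ, k1, k2⟩ := hcomb Q1 Q2 hQ1 hQ2 t s (by exact_mod_cast hts)
        refine ⟨⟨Q, hQ⟩, ?_, ?_⟩
        · dsimp only
          rw [k1]
          nlinarith [mul_le_mul_of_nonneg_left k2 hκ]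
        · dsimp only
          have : (t : ℝ) * δ + s * δ = δ := by rw [← add_mul, hts, one_mul]
          linarith)
      (by
        rintro ⟨Q, hQ⟩ hle
        dsimp only at hle ⊢
        have := hbound Q hQ.1 (by
          rw [hcoe Q hQ.2, EReal.coe_le_coe_iff]; linarith)
        exact_mod_cast this)
      ⟨empDist n z, iP, by rw [hself]; exact EReal.zero_lt_top⟩
      (by dsimp only; rw [hself]; simpa using hδ)
    have hη : 0 < (v - x) / δ := div_pos (by linarith) hδ
    refine absurd hx1 (not_lt.2 ?_)
    refine le_trans ?_ (le_iSup _ (⟨l + (v - x) / δ, by linarith⟩ : {l : ℝ // 0 < l}))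
    dsimp only
    have hin : ((x + (l + (v - x) / δ) * δ : ℝ) : EReal) ≤
        ⨅ Q : {Q : Measure 𝒵 // IsProbabilityMeasure Q ∧
              fDivOn a b f Q (empDist n z) < ⊤},
            ((∫ ζ, L ζ ∂(Q : Measure 𝒵) : ℝ) : EReal)
              + (((l + (v - x) / δ) + κ : ℝ) : EReal) * fDivOn a b f Q (empDist n z) := by
      refine le_iInf ?_
      rintro ⟨Q, hQ⟩
      have k1 := hl ⟨Q, hQ⟩
      have k2 := hnn Q hQ
      dsimp only at k1 ⊢
      rw [hcoe Q hQ.2]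
      rw [← EReal.coe_mul, ← EReal.coe_add, EReal.coe_le_coe_iff]
      have k3 := mul_nonneg hη.le k2
      have k4 : (v - x) / δ * δ = v - x := div_mul_cancel₀ _ hδ.ne'
      nlinarith
    refine le_trans ?_ (add_le_add le_rfl hin)
    rw [← EReal.coe_add, EReal.coe_le_coe_iff]
    linarith
  · refine iSup_le ?_
    rintro ⟨l, hl⟩
    refine le_iInf ?_
    rintro ⟨Q, hQ1, hQ2⟩
    have hlt := hQ2.trans_lt (EReal.coe_lt_top δ)
    refine le_trans (add_le_add le_rfl (iInf_le _ ⟨Q, hQ1, hlt⟩)) ?_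
    dsimp only
    have h := hcoe Q hlt
    rw [h] at hQ2 ⊢
    rw [EReal.coe_le_coe_iff] at hQ2
    rw [← EReal.coe_mul, ← EReal.coe_mul, ← EReal.coe_add, ← EReal.coe_add, ← EReal.coe_add,
      EReal.coe_le_coe_iff]
    nlinarith [mul_le_mul_of_nonneg_left hQ2 hl.le]
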